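/- arXiv:2512.18526 — 3 statements merged into one kernel-verified Lean document; each statement's English description precedes it below -/
import Mathlib

section
/- Read-only opacity theorem: let W be any read-only protocol map, i.e. any finite composition of steps of the two kinds (i) conjugation X ↦ Ũ X Ũᴴ by the extended U-QRAM unitary Ũ, and (ii) S-local Kraus steps X ↦ Σ_i (K_i ⊗ I_M) X (K_i ⊗ I_M)ᴴ with matrices K_i on ℂ^S satisfying Σ_i K_iᴴ K_i = I. Then for every matrix ρ_S on ℂ^S and every matrix ρ_M on ℂ^M, Tr_M(W(ρ_S ⊗ ρ_M)) = Tr_M(W(ρ_S ⊗ D(ρ_M))), where D(ρ_M)(m,m') = ρ_M(m,m') if m = m' and 0 otherwise, ⊗ is the Kronecker product indexed by S × M, and Tr_M is the partial trace over M. In particular the accessible output depends on ρ_M only through its diagonal in the truth-table basis. -/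
open Matrix

/-- The U-QRAM read unitary: the permutation matrix on `ℂ^(A × D × M)` induced by the
bijection `(a, y, m) ↦ (a, y XOR m a, m)`. -/
noncomputable def uqramU (n : ℕ) :
    Matrix (Fin (2^n) × Bool × (Fin (2^n) → Bool))
      (Fin (2^n) × Bool × (Fin (2^n) → Bool)) ℂ :=
  fun r c => if r = (c.1, xor c.2.1 (c.2.2 c.1), c.2.2) then 1 else 0

/-- The extended U-QRAM unitary `Ũ` on `ℂ^(S × M)` with `S = A × D × R`: it acts as `U`
on the `A × D × M` factors and as the identity on the ancilla `R`. -/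
noncomputable def uqramUtilde (n : ℕ) (R : Type) [DecidableEq R] :
    Matrix ((Fin (2^n) × Bool × R) × (Fin (2^n) → Bool))
      ((Fin (2^n) × Bool × R) × (Fin (2^n) → Bool)) ℂ :=
  fun p q =>
    if p.1.2.2 = q.1.2.2 then
      uqramU n (p.1.1, p.1.2.1, p.2) (q.1.1, q.1.2.1, q.2)
    else 0

/-- The Kronecker product `K ⊗ I_M` of a matrix `K` on `ℂ^S` with the identity on the
memory. -/
def krausExt {S : Type} {N : ℕ} (K : Matrix S S ℂ) :
    Matrix (S × (Fin N → Bool)) (S × (Fin N → Bool)) ℂ :=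
  fun p q => if p.2 = q.2 then K p.1 q.1 else 0

/-- The Kronecker product of a matrix on `ℂ^S` with a matrix on `ℂ^M`, indexed by
`S × M`. -/
def kron {S M : Type} (A : Matrix S S ℂ) (B : Matrix M M ℂ) :
    Matrix (S × M) (S × M) ℂ :=
  fun p q => A p.1 q.1 * B p.2 q.2

/-- Dephasing (pinching) in the truth-table basis on the memory: keep the diagonal
entries of `ρ_M` and zero the off-diagonal ones. -/
def deph {N : ℕ} (ρM : Matrix (Fin N → Bool) (Fin N → Bool) ℂ) :
    Matrix (Fin N → Bool) (Fin N → Bool) ℂ :=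
  fun m m' => if m = m' then ρM m m' else 0

/-- The partial trace over the memory of a matrix indexed by `S × M`:
`(Tr_M X)(s, s') = Σ_m X((s,m),(s',m))`. -/
noncomputable def ptraceMem {S : Type} {N : ℕ}
    (X : Matrix (S × (Fin N → Bool)) (S × (Fin N → Bool)) ℂ) :
    Matrix S S ℂ :=
  fun s s' => ∑ m : Fin N → Bool, X (s, m) (s', m)

/-- A read-only protocol map on matrices indexed by `S × M` (with `S = A × D × R`):
a finite composition of (i) conjugations `X ↦ Ũ X Ũᴴ` by the extended U-QRAM unitary and
(ii) S-local Kraus steps `X ↦ Σ_i (K_i ⊗ I_M) X (K_i ⊗ I_M)ᴴ` with `Σ_i K_iᴴ K_i = I`. -/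
inductive IsReadOnly (n : ℕ) (R : Type) [Fintype R] [DecidableEq R] :
    (Matrix ((Fin (2^n) × Bool × R) × (Fin (2^n) → Bool))
        ((Fin (2^n) × Bool × R) × (Fin (2^n) → Bool)) ℂ →
      Matrix ((Fin (2^n) × Bool × R) × (Fin (2^n) → Bool))
        ((Fin (2^n) × Bool × R) × (Fin (2^n) → Bool)) ℂ) → Prop
  | id : IsReadOnly n R id
  | read (W) (hW : IsReadOnly n R W) :
      IsReadOnly n R (fun X => uqramUtilde n R * W X * (uqramUtilde n R)ᴴ)
  | kraus (ι : Type) [Fintype ι]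
      (K : ι → Matrix (Fin (2^n) × Bool × R) (Fin (2^n) × Bool × R) ℂ)
      (hK : ∑ i, (K i)ᴴ * K i = 1) (W) (hW : IsReadOnly n R W) :
      IsReadOnly n R (fun X => ∑ i, krausExt (K i) * W X * (krausExt (K i))ᴴ)

/-- A matrix on `S × M` is block diagonal over the memory if it does not connect distinct
memory basis states. -/
def MemBlockDiagonal {S M : Type} (V : Matrix (S × M) (S × M) ℂ) : Prop :=
  ∀ p q, p.2 ≠ q.2 → V p q = 0

/-- Two matrices on `S × M` agree on the memory-diagonal blocks. -/
def MemDiagEq {S M : Type} (X Y : Matrix (S × M) (S × M) ℂ) : Prop :=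
  ∀ s s' m, X (s, m) (s', m) = Y (s, m) (s', m)

theorem MemBlockDiagonal.memDiagEq_conj {S M : Type} [Fintype S] [Fintype M]
    {V X Y : Matrix (S × M) (S × M) ℂ} (hV : MemBlockDiagonal V) (h : MemDiagEq X Y) :
    MemDiagEq (V * X * Vᴴ) (V * Y * Vᴴ) := by
  intro s s' m
  simp only [Matrix.mul_apply, Matrix.conjTranspose_apply, Finset.sum_mul]
  refine Finset.sum_congr rfl fun q _ => Finset.sum_congr rfl fun p _ => ?_
  obtain ⟨t, k⟩ := p
  obtain ⟨t', k'⟩ := q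
  by_cases hk : m = k
  · by_cases hk' : m = k'
    · subst hk hk'
      rw [h t t' m]
    · rw [hV (s', m) (t', k') hk']
      simp
  · rw [hV (s, m) (t, k) hk]
    simp

theorem memBlockDiagonal_krausExt {S : Type} {N : ℕ} (K : Matrix S S ℂ) :
    MemBlockDiagonal (krausExt (N := N) K) :=
  fun _ _ h => if_neg h

theorem memBlockDiagonal_uqramUtilde (n : ℕ) (R : Type) [DecidableEq R] :
    MemBlockDiagonal (uqramUtilde n R) := by
  intro p q h
  simp [uqramUtilde, uqramU, h]

theorem memDiagEq_kron_deph {S : Type} {N : ℕ} (A : Matrix S S ℂ)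
    (B : Matrix (Fin N → Bool) (Fin N → Bool) ℂ) :
    MemDiagEq (kron A B) (kron A (deph B)) := by
  intro s s' m
  simp [kron, deph]

theorem MemDiagEq.ptraceMem_eq {S : Type} {N : ℕ}
    {X Y : Matrix (S × (Fin N → Bool)) (S × (Fin N → Bool)) ℂ} (h : MemDiagEq X Y) :
    ptraceMem X = ptraceMem Y := by
  ext s s'
  exact Finset.sum_congr rfl fun m _ => h s s' m

theorem IsReadOnly.memDiagEq {n : ℕ} {R : Type} [Fintype R] [DecidableEq R]
    {W : Matrix ((Fin (2^n) × Bool × R) × (Fin (2^n) → Bool))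
        ((Fin (2^n) × Bool × R) × (Fin (2^n) → Bool)) ℂ →
      Matrix ((Fin (2^n) × Bool × R) × (Fin (2^n) → Bool))
        ((Fin (2^n) × Bool × R) × (Fin (2^n) → Bool)) ℂ}
    (hW : IsReadOnly n R W)
    {X Y : Matrix ((Fin (2^n) × Bool × R) × (Fin (2^n) → Bool))
        ((Fin (2^n) × Bool × R) × (Fin (2^n) → Bool)) ℂ} (h : MemDiagEq X Y) :
    MemDiagEq (W X) (W Y) := by
  induction hW with
  | id => exact h
  | read W _ ih => exact (memBlockDiagonal_uqramUtilde n R).memDiagEq_conj ih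
  | kraus ι K _ W _ ih =>
    intro s s' m
    simp only [Matrix.sum_apply]
    exact Finset.sum_congr rfl fun i _ =>
      (memBlockDiagonal_krausExt (K i)).memDiagEq_conj ih s s' m

/-- read-only opacity.  For any read-only protocol map `W`, the accessible
output `Tr_M(W(ρ_S ⊗ ρ_M))` depends on the memory state `ρ_M` only through its diagonal
in the truth-table basis: it is unchanged if `ρ_M` is replaced by its dephasing `D(ρ_M)`. -/
theorem readonly_opacity (n : ℕ) (R : Type) [Fintype R] [DecidableEq R]
    (W : Matrix ((Fin (2^n) × Bool × R) × (Fin (2^n) → Bool))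
        ((Fin (2^n) × Bool × R) × (Fin (2^n) → Bool)) ℂ →
      Matrix ((Fin (2^n) × Bool × R) × (Fin (2^n) → Bool))
        ((Fin (2^n) × Bool × R) × (Fin (2^n) → Bool)) ℂ)
    (hW : IsReadOnly n R W)
    (ρS : Matrix (Fin (2^n) × Bool × R) (Fin (2^n) × Bool × R) ℂ)
    (ρM : Matrix (Fin (2^n) → Bool) (Fin (2^n) → Bool) ℂ) :
    ptraceMem (W (kron ρS ρM)) = ptraceMem (W (kron ρS (deph ρM))) := by
  exact (hW.memDiagEq (memDiagEq_kron_deph ρS ρM)).ptraceMem_eq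
end

section
/- Separability of the joint output (entanglement-breaking form): let Q be a finite reference type, W any read-only protocol map extended as W ⊗ id_Q, ρ_S a matrix on ℂ^S, and ρ_{MQ} a positive semidefinite matrix on ℂ^(M×Q). For each m let σ_m = Tr_M(W(ρ_S ⊗ |m⟩⟨m|)) and let B_m be the matrix on ℂ^Q with entries B_m(q,q') = ρ_{MQ}((m,q),(m,q')). Then each B_m is positive semidefinite and the joint output satisfies Tr_M((W ⊗ id_Q)(ρ_S ⊗ ρ_{MQ})) = Σ_m σ_m ⊗ B_m (Kronecker product on S × Q); in particular the joint output is a sum of tensor products of positive semidefinite matrices, hence separable across S : Q. -/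
open Matrix

/-- The extension `T ⊗ I_Q` of a matrix `T` on `ℂ^A` by the identity on a reference
system `Q`. -/
def refExt {A Q : Type} [DecidableEq Q] (T : Matrix A A ℂ) :
    Matrix (A × Q) (A × Q) ℂ :=
  fun p q => if p.2 = q.2 then T p.1 q.1 else 0

/-- A single step of a read-only protocol: either a read (conjugation by the extended
U-QRAM unitary `Ũ`) or an S-local Kraus step given by a finite family of matrices on
`ℂ^S`. -/
inductive Step (n : ℕ) (R : Type) : Type
  | read : Step n R
  | kraus (k : ℕ)
      (K : Fin k → Matrix (Fin (2^n) × Bool × R) (Fin (2^n) × Bool × R) ℂ) : Step n R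

/-- Validity of a step: Kraus steps must satisfy the normalization `Σ_i K_iᴴ K_i = I`. -/
def Step.Valid {n : ℕ} {R : Type} [Fintype R] [DecidableEq R] : Step n R → Prop
  | .read => True
  | .kraus _ K => ∑ i, (K i)ᴴ * K i = 1

/-- The action of a step on matrices indexed by `(S × M) × Q`, acting as before on the
`S × M` factors and as the identity on the reference `Q`. -/
noncomputable def Step.actQ {n : ℕ} {R : Type} [Fintype R] [DecidableEq R]
    (Q : Type) [Fintype Q] [DecidableEq Q] :
    Step n R →
      Matrix ((((Fin (2^n) × Bool × R) × (Fin (2^n) → Bool))) × Q)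
          ((((Fin (2^n) × Bool × R) × (Fin (2^n) → Bool))) × Q) ℂ →
      Matrix ((((Fin (2^n) × Bool × R) × (Fin (2^n) → Bool))) × Q)
          ((((Fin (2^n) × Bool × R) × (Fin (2^n) → Bool))) × Q) ℂ
  | .read => fun X =>
      refExt (uqramUtilde n R) * X * (refExt (uqramUtilde n R))ᴴ
  | .kraus _ K => fun X =>
      ∑ i, refExt (krausExt (K i)) * X * (refExt (krausExt (K i)))ᴴ

/-- The extended action `W ⊗ id_Q` of a read-only protocol (a finite list of steps) on
matrices indexed by `(S × M) × Q`. -/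
noncomputable def protocolActQ {n : ℕ} {R : Type} [Fintype R] [DecidableEq R]
    (Q : Type) [Fintype Q] [DecidableEq Q] (L : List (Step n R)) :
    Matrix ((((Fin (2^n) × Bool × R) × (Fin (2^n) → Bool))) × Q)
        ((((Fin (2^n) × Bool × R) × (Fin (2^n) → Bool))) × Q) ℂ →
    Matrix ((((Fin (2^n) × Bool × R) × (Fin (2^n) → Bool))) × Q)
        ((((Fin (2^n) × Bool × R) × (Fin (2^n) → Bool))) × Q) ℂ :=
  L.foldr (fun st f => st.actQ Q ∘ f) id

/-- The joint input `ρ_S ⊗ ρ_{MQ}` as a matrix indexed by `(S × M) × Q`. -/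
def kronSMQ {S Q : Type} {N : ℕ} (ρS : Matrix S S ℂ)
    (ρMQ : Matrix ((Fin N → Bool) × Q) ((Fin N → Bool) × Q) ℂ) :
    Matrix ((S × (Fin N → Bool)) × Q) ((S × (Fin N → Bool)) × Q) ℂ :=
  fun p q => ρS p.1.1 q.1.1 * ρMQ (p.1.2, p.2) (q.1.2, q.2)

/-- The dephasing `(D ⊗ id_Q)` of the memory component of a matrix on `ℂ^(M × Q)`:
it keeps the truth-table-diagonal blocks and zeroes the others. -/
def dephQ {Q : Type} {N : ℕ}
    (ρMQ : Matrix ((Fin N → Bool) × Q) ((Fin N → Bool) × Q) ℂ) :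
    Matrix ((Fin N → Bool) × Q) ((Fin N → Bool) × Q) ℂ :=
  fun p q => if p.1 = q.1 then ρMQ p q else 0

/-- The partial trace over the memory of a matrix indexed by `(S × M) × Q`, yielding a
matrix on `ℂ^(S × Q)`. -/
noncomputable def ptraceMemQ {S Q : Type} {N : ℕ}
    (X : Matrix ((S × (Fin N → Bool)) × Q) ((S × (Fin N → Bool)) × Q) ℂ) :
    Matrix (S × Q) (S × Q) ℂ :=
  fun p q => ∑ m : Fin N → Bool, X ((p.1, m), p.2) ((q.1, m), q.2)
open scoped ComplexOrder

/-- The action of a step on matrices indexed by `S × M` (no reference system). -/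
noncomputable def Step.actSM {n : ℕ} {R : Type} [Fintype R] [DecidableEq R] :
    Step n R →
      Matrix ((Fin (2^n) × Bool × R) × (Fin (2^n) → Bool))
          ((Fin (2^n) × Bool × R) × (Fin (2^n) → Bool)) ℂ →
      Matrix ((Fin (2^n) × Bool × R) × (Fin (2^n) → Bool))
          ((Fin (2^n) × Bool × R) × (Fin (2^n) → Bool)) ℂ
  | .read => fun X => uqramUtilde n R * X * (uqramUtilde n R)ᴴ
  | .kraus _ K => fun X => ∑ i, krausExt (K i) * X * (krausExt (K i))ᴴ

/-- The action of a read-only protocol (a finite list of steps) on matrices indexed by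
`S × M`. -/
noncomputable def protocolActSM {n : ℕ} {R : Type} [Fintype R] [DecidableEq R]
    (L : List (Step n R)) :
    Matrix ((Fin (2^n) × Bool × R) × (Fin (2^n) → Bool))
        ((Fin (2^n) × Bool × R) × (Fin (2^n) → Bool)) ℂ →
    Matrix ((Fin (2^n) × Bool × R) × (Fin (2^n) → Bool))
        ((Fin (2^n) × Bool × R) × (Fin (2^n) → Bool)) ℂ :=
  L.foldr (fun st f => st.actSM ∘ f) id

/-- The rank-one matrix `|m⟩⟨m|` on `ℂ^M`, with a single `1` in entry `(m, m)`. -/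
def ketbra {N : ℕ} (m : Fin N → Bool) :
    Matrix (Fin N → Bool) (Fin N → Bool) ℂ :=
  fun x y => if x = m ∧ y = m then 1 else 0

/-- If the rows of `T` selected by an injective `f` are supported on the range of `f`, then
selecting these rows of `T * X` only involves the corresponding rows of `X`. -/
theorem submatrix_mul_of_supported {ι κ μ ν : Type*} [Fintype ι] [Fintype κ]
    {T : Matrix ι ι ℂ} (X : Matrix ι μ ℂ) {f : κ → ι} (g : ν → μ) (hf : Function.Injective f)
    (hT : ∀ s, ∀ k ∉ Set.range f, T (f s) k = 0) :
    (T * X).submatrix f g = T.submatrix f f * X.submatrix f g := by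
  ext s t
  simp only [submatrix_apply, mul_apply]
  exact (Fintype.sum_of_injective f hf _ _
    (fun k hk => by rw [hT s k hk, zero_mul]) (fun _ => rfl)).symm

/-- Conjugation by a matrix that preserves the index sets selected by `f` and `g` acts on the
`(f, g)` block by the corresponding diagonal blocks. -/
theorem submatrix_conj_of_supported {ι κ : Type*} [Fintype ι] [Fintype κ]
    {T : Matrix ι ι ℂ} (X : Matrix ι ι ℂ) {f g : κ → ι}
    (hf : Function.Injective f) (hg : Function.Injective g)
    (hTf : ∀ s, ∀ k ∉ Set.range f, T (f s) k = 0)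
    (hTg : ∀ s, ∀ k ∉ Set.range g, T (g s) k = 0) :
    (T * X * Tᴴ).submatrix f g =
      T.submatrix f f * X.submatrix f g * (T.submatrix g g)ᴴ := by
  have h : (X * Tᴴ).submatrix f g = X.submatrix f g * (T.submatrix g g)ᴴ := by
    have h' := congrArg conjTranspose (submatrix_mul_of_supported Xᴴ f hg hTg)
    simpa [conjTranspose_submatrix, conjTranspose_mul] using h'
  rw [Matrix.mul_assoc, submatrix_mul_of_supported (X * Tᴴ) g hf hTf, h, Matrix.mul_assoc]

/-- The linear map `X ↦ A X Aᴴ`. -/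
noncomputable def conjLinear {S : Type} [Fintype S] (A : Matrix S S ℂ) :
    Matrix S S ℂ →ₗ[ℂ] Matrix S S ℂ :=
  LinearMap.mulRight ℂ Aᴴ ∘ₗ LinearMap.mulLeft ℂ A

/-- A matrix on `ℂ^(S × M)` is memory-diagonal if it has no entries between different memory
contents. -/
def MemDiag {S M : Type} (T : Matrix (S × M) (S × M) ℂ) : Prop :=
  ∀ p q, p.2 ≠ q.2 → T p q = 0

theorem MemDiag.conj_block {S M : Type} [Fintype S] [Fintype M]
    {T : Matrix (S × M) (S × M) ℂ} (hT : MemDiag T) (X : Matrix (S × M) (S × M) ℂ) (m : M) :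
    (T * X * Tᴴ).submatrix (·, m) (·, m) =
      conjLinear (T.submatrix (·, m) (·, m)) (X.submatrix (·, m) (·, m)) := by
  have hinj : Function.Injective fun s : S => (s, m) := Prod.mk_left_injective m
  have hsupp : ∀ s, ∀ k ∉ Set.range (fun s : S => (s, m)), T (s, m) k = 0 := by
    rintro s ⟨t, m'⟩ hk
    exact hT _ _ fun h => hk ⟨t, by simpa using h⟩
  exact submatrix_conj_of_supported X hinj hinj hsupp hsupp

theorem MemDiag.conj_refExt_block {S M Q : Type} [Fintype S] [Fintype M] [Fintype Q]
    [DecidableEq Q] {T : Matrix (S × M) (S × M) ℂ} (hT : MemDiag T)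
    (X : Matrix ((S × M) × Q) ((S × M) × Q) ℂ) (m : M) (q q' : Q) :
    (refExt T * X * (refExt T)ᴴ).submatrix (fun s => ((s, m), q)) (fun s => ((s, m), q')) =
      conjLinear (T.submatrix (·, m) (·, m))
        (X.submatrix (fun s => ((s, m), q)) (fun s => ((s, m), q'))) := by
  have hinj (r : Q) : Function.Injective fun s : S => ((s, m), r) :=
    (Prod.mk_left_injective r).comp (Prod.mk_left_injective m)
  have hsupp (r : Q) : ∀ s, ∀ k ∉ Set.range (fun s : S => ((s, m), r)),
      refExt (Q := Q) T ((s, m), r) k = 0 := by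
    rintro s ⟨⟨t, m'⟩, r'⟩ hk
    rw [refExt, ite_eq_right_iff]
    intro hr
    exact hT _ _ fun h => hk ⟨t, by simp_all⟩
  have hblock (r : Q) : (refExt T).submatrix (fun s => ((s, m), r)) (fun s => ((s, m), r)) =
      T.submatrix (·, m) (·, m) := by
    ext s t
    simp [refExt]
  rw [submatrix_conj_of_supported X (hinj q) (hinj q') (hsupp q) (hsupp q'), hblock, hblock]
  rfl

theorem memDiag_uqramUtilde (n : ℕ) (R : Type) [DecidableEq R] : MemDiag (uqramUtilde n R) := by
  intro p q h
  simp [uqramUtilde, uqramU, h]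

theorem memDiag_krausExt {S : Type} {N : ℕ} (K : Matrix S S ℂ) :
    MemDiag (krausExt (N := N) K) :=
  fun _ _ h => if_neg h

/-- The action of a protocol on the diagonal block of the memory content `m`. -/
noncomputable def protocolBlock {n : ℕ} {R : Type} [Fintype R] [DecidableEq R]
    (m : Fin (2^n) → Bool) : List (Step n R) →
      Matrix (Fin (2^n) × Bool × R) (Fin (2^n) × Bool × R) ℂ →ₗ[ℂ]
        Matrix (Fin (2^n) × Bool × R) (Fin (2^n) × Bool × R) ℂ
  | [] => LinearMap.id
  | .read :: L => conjLinear ((uqramUtilde n R).submatrix (·, m) (·, m)) ∘ₗ protocolBlock m L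
  | .kraus _ K :: L =>
      (∑ i, conjLinear ((krausExt (K i)).submatrix (·, m) (·, m))) ∘ₗ protocolBlock m L

theorem submatrix_finset_sum {ι κ l o : Type*} (s : Finset ι) (X : ι → Matrix κ κ ℂ)
    (f : l → κ) (g : o → κ) :
    (∑ i ∈ s, X i).submatrix f g = ∑ i ∈ s, (X i).submatrix f g := by
  ext
  simp [Matrix.sum_apply]

theorem protocolActSM_block {n : ℕ} {R : Type} [Fintype R] [DecidableEq R]
    (L : List (Step n R))
    (X : Matrix ((Fin (2^n) × Bool × R) × (Fin (2^n) → Bool))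
      ((Fin (2^n) × Bool × R) × (Fin (2^n) → Bool)) ℂ) (m : Fin (2^n) → Bool) :
    (protocolActSM L X).submatrix (·, m) (·, m) =
      protocolBlock m L (X.submatrix (·, m) (·, m)) := by
  induction L with
  | nil => rfl
  | cons st L ih =>
    change (st.actSM (protocolActSM L X)).submatrix _ _ = _
    cases st with
    | read =>
      simp only [Step.actSM, (memDiag_uqramUtilde n R).conj_block, ih, protocolBlock,
        LinearMap.comp_apply]
    | kraus k K =>
      simp only [Step.actSM, submatrix_finset_sum, (memDiag_krausExt _).conj_block, ih,
        protocolBlock, LinearMap.comp_apply, LinearMap.sum_apply]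

theorem protocolActQ_block {n : ℕ} {R : Type} [Fintype R] [DecidableEq R]
    {Q : Type} [Fintype Q] [DecidableEq Q] (L : List (Step n R))
    (X : Matrix (((Fin (2^n) × Bool × R) × (Fin (2^n) → Bool)) × Q)
      (((Fin (2^n) × Bool × R) × (Fin (2^n) → Bool)) × Q) ℂ)
    (m : Fin (2^n) → Bool) (q q' : Q) :
    (protocolActQ Q L X).submatrix (fun s => ((s, m), q)) (fun s => ((s, m), q')) =
      protocolBlock m L (X.submatrix (fun s => ((s, m), q)) (fun s => ((s, m), q'))) := by
  induction L with
  | nil => rfl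
  | cons st L ih =>
    change (st.actQ Q (protocolActQ Q L X)).submatrix _ _ = _
    cases st with
    | read =>
      simp only [Step.actQ, (memDiag_uqramUtilde n R).conj_refExt_block, ih, protocolBlock,
        LinearMap.comp_apply]
    | kraus k K =>
      simp only [Step.actQ, submatrix_finset_sum, (memDiag_krausExt _).conj_refExt_block, ih,
        protocolBlock, LinearMap.comp_apply, LinearMap.sum_apply]

theorem ptraceMem_protocolActSM_ketbra {n : ℕ} {R : Type} [Fintype R] [DecidableEq R]
    (L : List (Step n R)) (ρS : Matrix (Fin (2^n) × Bool × R) (Fin (2^n) × Bool × R) ℂ)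
    (m : Fin (2^n) → Bool) :
    ptraceMem (protocolActSM L (kron ρS (ketbra m))) = protocolBlock m L ρS := by
  have hsum (X : Matrix ((Fin (2^n) × Bool × R) × (Fin (2^n) → Bool))
      ((Fin (2^n) × Bool × R) × (Fin (2^n) → Bool)) ℂ) :
      ptraceMem X = ∑ m', X.submatrix (·, m') (·, m') := by
    ext s s'
    simp [ptraceMem, Matrix.sum_apply]
  have hblock (m' : Fin (2^n) → Bool) : (kron ρS (ketbra m)).submatrix (·, m') (·, m') =
      if m' = m then ρS else 0 := by
    ext s s'
    by_cases h : m' = m <;> simp [kron, ketbra, h]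
  simp only [hsum, protocolActSM_block, hblock, apply_ite, map_zero, Finset.sum_ite_eq',
    Finset.mem_univ, if_true]

/-- separability of the joint output (entanglement-breaking form).
For a positive semidefinite joint memory–reference state `ρ_{MQ}`, the joint output of
any read-only protocol extended by `id_Q` equals `Σ_m σ_m ⊗ B_m`, where
`σ_m = Tr_M(W(ρ_S ⊗ |m⟩⟨m|))` and `B_m(q,q') = ρ_{MQ}((m,q),(m,q'))` is positive
semidefinite; hence the joint output is separable across `S : Q`. -/
theorem readonly_output_separable (n : ℕ) (R : Type) [Fintype R] [DecidableEq R]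
    (Q : Type) [Fintype Q] [DecidableEq Q]
    (L : List (Step n R)) (hL : ∀ st ∈ L, st.Valid)
    (ρS : Matrix (Fin (2^n) × Bool × R) (Fin (2^n) × Bool × R) ℂ)
    (ρMQ : Matrix ((Fin (2^n) → Bool) × Q) ((Fin (2^n) → Bool) × Q) ℂ)
    (hρMQ : ρMQ.PosSemidef) :
    (∀ m : Fin (2^n) → Bool,
        (Matrix.of fun q q' : Q => ρMQ (m, q) (m, q')).PosSemidef) ∧
    ptraceMemQ (protocolActQ Q L (kronSMQ ρS ρMQ)) =
      ∑ m : Fin (2^n) → Bool,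
        kron (ptraceMem (protocolActSM L (kron ρS (ketbra m))))
          (Matrix.of fun q q' : Q => ρMQ (m, q) (m, q')) := by
  refine ⟨fun m => hρMQ.submatrix (m, ·), ?_⟩
  ext ⟨s, q⟩ ⟨s', q'⟩
  rw [Matrix.sum_apply]
  refine Finset.sum_congr rfl fun m _ => ?_
  have hinput : (kronSMQ ρS ρMQ).submatrix (fun s => ((s, m), q)) (fun s => ((s, m), q')) =
      ρMQ (m, q) (m, q') • ρS := by
    ext t t'
    simp [kronSMQ, mul_comm]
  have h := congrFun₂ (protocolActQ_block L (kronSMQ ρS ρMQ) m q q') s s'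
  rw [hinput, map_smul] at h
  simpa [kron, ptraceMem_protocolActSM_ketbra, mul_comm] using h
end

section
/- Success probability bound via total variation: let J be a finite index type, {σ_j}_{j ∈ J} density matrices on ℂ^d, p₀, p₁ : J → ℝ probability distributions, and σ⁽ʰ⁾ = Σ_j p_h(j)·σ_j for h = 0, 1. Then for every matrix E with 0 ≤ E ≤ I, the equal-prior success probability satisfies (1/2)·Tr(E σ⁽⁰⁾) + (1/2)·Tr((I − E) σ⁽¹⁾) ≤ (1/2)·(1 + TV(p₀, p₁)). -/
open Matrix
open scoped ComplexOrder

/-- The trace of a product of two positive semidefinite matrices is nonnegative. -/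
theorem Matrix.PosSemidef.trace_mul_nonneg {n : Type*} [Fintype n]
    {A B : Matrix n n ℂ} (hA : A.PosSemidef) (hB : B.PosSemidef) : 0 ≤ (A * B).trace := by
  classical
  open scoped MatrixOrder in
  obtain ⟨C, rfl⟩ := CStarAlgebra.nonneg_iff_eq_star_mul_self.mp hB.nonneg
  rw [Matrix.star_eq_conjTranspose]
  rw [← Matrix.mul_assoc, Matrix.trace_mul_comm, ← Matrix.mul_assoc]
  exact (hA.mul_mul_conjTranspose_same C).trace_nonneg

/-- The real part of `Tr(A ·)` is affine along a real-weighted mixture. -/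
theorem Matrix.re_trace_mul_sum_smul {n J : Type*} [Fintype n] [Fintype J]
    (A : Matrix n n ℂ) (p : J → ℝ) (σ : J → Matrix n n ℂ) :
    (A * ∑ j, (p j : ℂ) • σ j).trace.re = ∑ j, p j * (A * σ j).trace.re := by
  simp [Matrix.mul_sum, Matrix.trace_sum]

/-- success probability bound via total variation.  For density matrices
`{σ_j}`, probability distributions `p₀, p₁` on a finite set `J`, the mixtures
`σ⁽ʰ⁾ = Σ_j p_h(j) σ_j`, and any effect `0 ≤ E ≤ I`, the equal-prior success probability
`(1/2) Tr(E σ⁽⁰⁾) + (1/2) Tr((I−E) σ⁽¹⁾)` is at most `(1/2)(1 + TV(p₀, p₁))`. -/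
theorem success_le_half_one_add_tv {d : ℕ} {J : Type*} [Fintype J]
    (σ : J → Matrix (Fin d) (Fin d) ℂ)
    (hσ : ∀ j, (σ j).PosSemidef) (hσt : ∀ j, (σ j).trace = 1)
    (p₀ p₁ : J → ℝ)
    (hp₀ : ∀ j, 0 ≤ p₀ j) (hp₀s : ∑ j, p₀ j = 1)
    (hp₁ : ∀ j, 0 ≤ p₁ j) (hp₁s : ∑ j, p₁ j = 1)
    (E : Matrix (Fin d) (Fin d) ℂ) (hE : E.PosSemidef) (hE' : (1 - E).PosSemidef) :
    (1 / 2) * ((E * ∑ j, (p₀ j : ℂ) • σ j).trace).re +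
        (1 / 2) * (((1 - E) * ∑ j, (p₁ j : ℂ) • σ j).trace).re ≤
      (1 / 2) * (1 + (1 / 2) * ∑ j, |p₀ j - p₁ j|) := by
  have key : ∀ j, p₀ j * (E * σ j).trace.re + p₁ j * ((1 - E) * σ j).trace.re ≤
      (1 / 2) * (p₀ j + p₁ j + |p₀ j - p₁ j|) := by
    intro j
    have h0 := (Complex.le_def.mp (hE.trace_mul_nonneg (hσ j))).1
    have h1 := (Complex.le_def.mp (hE'.trace_mul_nonneg (hσ j))).1
    have hsum : ((1 - E) * σ j).trace.re = 1 - (E * σ j).trace.re := by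
      simp [Matrix.sub_mul, hσt j]
    rw [hsum] at h1 ⊢
    rw [Complex.zero_re] at h0 h1
    rcases abs_cases (p₀ j - p₁ j) with ⟨h, hs⟩ | ⟨h, hs⟩ <;> rw [h] <;> nlinarith
  have total := Finset.sum_le_sum fun j (_ : j ∈ Finset.univ) => key j
  rw [← Finset.mul_sum, Finset.sum_add_distrib, Finset.sum_add_distrib, Finset.sum_add_distrib,
    hp₀s, hp₁s] at total
  rw [Matrix.re_trace_mul_sum_smul, Matrix.re_trace_mul_sum_smul]
  linarith
end
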